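/- Let P be a transition matrix associated with G, P̄ its lift to the spanning tree graph, and m' the integer-valued function on strongly connected subsets of V defined by m'(V) = 1 and m'(W) = k(W) − ∑_{W' strongly connected, W ⊊ W' ⊆ V} m'(W') for strongly connected W ⊊ V. For any s : V → ℝ, let S = Matrix.diagonal s and let S̄ : Matrix V̄ V̄ ℝ be the diagonal matrix with S̄ t t = s (root t). Then det(1 − S̄ * P̄) · ∏_W det((1 − S*P)|_W)^{(−m'(W))₊} = det(1 − S*P) · ∏_W det((1 − S*P)|_W)^{(m'(W))₊}, where both products range over all strongly connected proper subsets W ⊊ V. (Equivalently, det(1 − S̄P̄)/det(1 − SP) = ∏_W det((1 − SP)|_W)^{m'(W)}.) -/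

import Mathlib

open Matrix Finset Classical

noncomputable section

/-- A directed rooted spanning tree of the graph with edge set `E`, rooted at `r`,
encoded as the "parent" function `t`. -/
def IsSpanningTree {V : Type*} (E : Set (V × V)) (r : V) (t : V → V) : Prop :=
  t r = r ∧ (∀ v, v ≠ r → (v, t v) ∈ E) ∧ ∀ v, ∃ n, t^[n] v = r

/-- The set `V̄` of all spanning trees of the graph, over all roots, as a type:
a pair of the parent function and the root. -/
abbrev STree {V : Type*} (E : Set (V × V)) : Type _ :=
  {p : (V → V) × V // IsSpanningTree E p.2 p.1}

def STree.tree {V : Type*} {E : Set (V × V)} (t : STree E) : V → V := t.1.1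

def STree.root {V : Type*} {E : Set (V × V)} (t : STree E) : V := t.1.2

noncomputable instance STree.instFintype {V : Type*} [Finite V] {E : Set (V × V)} :
    Fintype (STree E) := Fintype.ofFinite _

/-- The edge relation of the spanning tree graph `Ḡ`. -/
def STreeEdge {V : Type*} [DecidableEq V] (E : Set (V × V)) (t t' : STree E) : Prop :=
  t.root ≠ t'.root ∧ (t.root, t'.root) ∈ E ∧
    t'.tree = Function.update (Function.update t.tree t.root t'.root) t'.root t'.root

/-- The edge set of the spanning tree graph `Ḡ`. -/
def liftEdges {V : Type*} [DecidableEq V] (E : Set (V × V)) : Set (STree E × STree E) :=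
  {p | STreeEdge E p.1 p.2}

/-- The graph `(V, E)` is strongly connected. -/
def StronglyConnected {V : Type*} (E : Set (V × V)) : Prop :=
  ∀ u v : V, Relation.ReflTransGen (fun a b => (a, b) ∈ E) u v

/-- `W` is a (nonempty) strongly connected subset of the vertices: any two vertices of `W`
are joined by a directed path staying inside `W`. -/
def StronglyConnectedSub {V : Type*} (E : Set (V × V)) (W : Finset V) : Prop :=
  W.Nonempty ∧ ∀ u ∈ W, ∀ v ∈ W,
    Relation.ReflTransGen (fun a b => a ∈ W ∧ b ∈ W ∧ (a, b) ∈ E) u v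

/-- `P` is a transition matrix associated with the graph `(V, E)`. -/
def IsTransMatrix {V : Type*} [Fintype V] (E : Set (V × V)) (P : Matrix V V ℝ) : Prop :=
  (∀ i j, 0 ≤ P i j) ∧ (∀ i, ∑ j, P i j = 1) ∧ ∀ i j, i ≠ j → (0 < P i j ↔ (i, j) ∈ E)

/-- The lift `P̄` of the matrix `P` to the spanning tree graph. -/
def liftP {V : Type*} [DecidableEq V] (E : Set (V × V)) (P : Matrix V V ℝ) :
    Matrix (STree E) (STree E) ℝ :=
  fun t t' => if t = t' then P t.root t.root
    else if STreeEdge E t t' then P t.root t'.root else 0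

/-- A directed rooted spanning forest of the graph with edge set `E`, rooted in `W`. -/
def IsSpanningForest {V : Type*} (E : Set (V × V)) (W : Finset V) (f : V → V) : Prop :=
  (∀ w ∈ W, f w = w) ∧ (∀ v, v ∉ W → (v, f v) ∈ E) ∧ ∀ v, ∃ n, f^[n] v ∈ W

/-- `k(W)`: the number of spanning forests rooted in `W`. -/
def kForest {V : Type*} (E : Set (V × V)) (W : Finset V) : ℕ :=
  Nat.card {f : V → V // IsSpanningForest E W f}

/-- The `W × W` submatrix of `A` (rows and columns indexed by `W`). -/
def subm {V : Type*} {R : Type*} (A : Matrix V V R) (W : Finset V) : Matrix W W R :=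
  A.submatrix (fun i => (i : V)) (fun j => (j : V))

/-- `Ψ_W`: the sum of the weights of the spanning forests rooted in `W`,
for edge weights `x`. -/
def forestWeightSum {V : Type*} [Fintype V] [DecidableEq V] (E : Set (V × V))
    (x : V → V → ℝ) (W : Finset V) : ℝ :=
  ∑ f ∈ Finset.univ.filter (IsSpanningForest E W),
    ∏ v ∈ Finset.univ.filter (fun v => v ∉ W), x v (f v)

/-- The weight of a spanning tree: product of edge weights over non-root vertices. -/
def treeWeight {V : Type*} [Fintype V] [DecidableEq V] {E : Set (V × V)}
    (x : V → V → ℝ) (t : STree E) : ℝ :=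
  ∏ v ∈ Finset.univ.erase t.root, x v (t.tree v)

/-- `step(t, j)`: move the root of the (rooted function) `p` along the edge to `j`. -/
def stepF {V : Type*} [DecidableEq V] (E : Set (V × V)) (p : (V → V) × V) (j : V) :
    (V → V) × V :=
  if j = p.2 then p
  else if (p.2, j) ∈ E then (Function.update (Function.update p.1 p.2 j) j j, j)
  else p

/-- `traverse(c, p)`: successively apply `step` with the vertices `c 1, c 2, …, c (n-1), c 0`. -/
def traverse {V : Type*} [DecidableEq V] (E : Set (V × V)) (n : ℕ) (c : ZMod n → V)
    (p : (V → V) × V) : (V → V) × V :=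
  (List.range n).foldl (fun q i => stepF E q (c ((i : ZMod n) + 1))) p


section LinAlg
open Polynomial

variable {n : Type*} [Fintype n] [DecidableEq n]

theorem aux_deriv_det (M : Matrix n n ℝ[X]) :
    derivative M.det = (M.adjugate * M.map derivative).trace := by
  have h1 : ∀ i, (M.adjugate * M.map derivative) i i
      = (M.updateCol i (fun k => derivative (M k i))).det := by
    intro i
    rw [← Matrix.cramer_apply, Matrix.cramer_eq_adjugate_mulVec]
    rfl
  rw [Matrix.trace]
  simp only [Matrix.diag_apply, h1, Matrix.det_apply]
  rw [Finset.sum_comm, derivative_sum]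
  refine Finset.sum_congr rfl fun σ _ => ?_
  rw [← Finset.smul_sum]
  have : ∀ (u : ℤˣ) (p : ℝ[X]), derivative (u • p) = u • derivative p := by
    intro u p
    rcases Int.units_eq_one_or u with h | h <;> simp [h]
  rw [this, derivative_prod_finset]
  congr 1
  refine Finset.sum_congr rfl fun i hi => ?_
  rw [← Finset.prod_erase_mul _ _ hi, Matrix.updateCol_self]
  congr 1
  refine Finset.prod_congr rfl fun j hj => ?_
  rw [Matrix.updateCol_ne (Finset.ne_of_mem_erase hj)]

/-- generating series of the traces -/
def trSeries (A : Matrix n n ℝ) : PowerSeries ℝ := PowerSeries.mk fun k => (A ^ (k + 1)).trace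

/-- logarithmic derivative predicate -/
def LD (F T : PowerSeries ℝ) : Prop := PowerSeries.derivative ℝ F = F * T

theorem LD.mul {F G S T : PowerSeries ℝ} (h : LD F S) (h' : LD G T) : LD (F * G) (S + T) := by
  unfold LD at *
  rw [Derivation.leibniz, h, h']
  simp only [smul_eq_mul]; ring

theorem LD.one : LD 1 0 := by simp [LD]

theorem LD.pow {F T : PowerSeries ℝ} (h : LD F T) (k : ℕ) : LD (F ^ k) (k • T) := by
  induction k with
  | zero => simpa using LD.one
  | succ k ih => rw [pow_succ, succ_nsmul]; exact ih.mul h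

theorem LD.prod {ι : Type*} (s : Finset ι) (F T : ι → PowerSeries ℝ) (h : ∀ i, LD (F i) (T i)) :
    LD (∏ i ∈ s, F i) (∑ i ∈ s, T i) := by
  classical
  induction s using Finset.induction_on with
  | empty => simpa using LD.one
  | insert a s ha ih => rw [Finset.prod_insert ha, Finset.sum_insert ha]; exact (h a).mul ih

theorem LD.unique {F G T : PowerSeries ℝ} (hF : LD F T) (hG : LD G T)
    (h1 : PowerSeries.constantCoeff F = 1) (h2 : PowerSeries.constantCoeff G = 1) : F = G := by
  have hne : PowerSeries.constantCoeff G ≠ 0 := by rw [h2]; norm_num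
  have hinv : G * G⁻¹ = 1 := PowerSeries.mul_inv_cancel _ hne
  have : F * G⁻¹ = 1 := by
    apply PowerSeries.derivative.ext
    · rw [Derivation.leibniz, PowerSeries.derivative_inv', hF, hG]
      simp only [smul_eq_mul, PowerSeries.derivative_one]
      linear_combination (-F * G⁻¹ * T) * hinv
    · simp [h1, h2]
  calc F = F * (G * G⁻¹) := by rw [hinv, mul_one]
    _ = (F * G⁻¹) * G := by ring
    _ = G := by rw [this, one_mul]

theorem LD.charpolyRev (A : Matrix n n ℝ) :
    LD (A.charpolyRev : PowerSeries ℝ) (-trSeries A) := by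
  unfold LD
  rw [PowerSeries.derivative_coe]
  let φ : ℝ[X] →+* PowerSeries ℝ := Polynomial.coeToPowerSeries.ringHom
  have hφ : ∀ p : ℝ[X], (p : PowerSeries ℝ) = φ p := fun p => rfl
  let M : Matrix n n ℝ[X] := 1 - (X : ℝ[X]) • A.map C
  have hM : A.charpolyRev = M.det := rfl
  have hM' : M.map derivative = - A.map C := by
    ext i j : 2
    simp only [M, Matrix.map_apply, Matrix.sub_apply, Matrix.smul_apply, Matrix.one_apply,
      Matrix.neg_apply, smul_eq_mul]
    split_ifs <;> simp
  let G : Matrix n n (PowerSeries ℝ) := fun i j => PowerSeries.mk fun k => (A ^ k) i j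
  have hMG : (φ.mapMatrix M) * G = 1 := by
    have e : φ.mapMatrix M = 1 - (PowerSeries.X : PowerSeries ℝ) • A.map (PowerSeries.C) := by
      ext i j : 2
      simp only [M, RingHom.mapMatrix_apply, Matrix.map_apply, Matrix.sub_apply, Matrix.smul_apply,
        Matrix.one_apply, smul_eq_mul, ← hφ]
      split_ifs <;> simp <;> exact mul_comm _ _
    rw [e, sub_mul, one_mul, smul_mul_assoc]
    ext i j k
    rw [Matrix.sub_apply, Matrix.smul_apply, smul_eq_mul, map_sub]
    cases k with
    | zero =>
      by_cases h : i = j <;> simp [G, h, Matrix.one_apply, PowerSeries.coeff_one]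
    | succ k =>
      rw [mul_comm, PowerSeries.coeff_succ_mul_X, Matrix.mul_apply, map_sum]
      simp only [G, Matrix.map_apply, PowerSeries.coeff_C_mul, PowerSeries.coeff_mk]
      rw [pow_succ', Matrix.mul_apply, sub_self, Matrix.one_apply]
      split_ifs <;> simp [PowerSeries.coeff_one]
  have hadj : φ.mapMatrix M.adjugate = φ M.det • G := by
    calc φ.mapMatrix M.adjugate = φ.mapMatrix M.adjugate * (φ.mapMatrix M * G) := by
          rw [hMG, mul_one]
      _ = φ.mapMatrix (M.adjugate * M) * G := by rw [← mul_assoc, map_mul]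
      _ = _ := by
          rw [Matrix.adjugate_mul]
          have : φ.mapMatrix (M.det • (1 : Matrix n n ℝ[X])) = φ M.det • 1 := by
            ext i j : 2
            simp only [RingHom.mapMatrix_apply, Matrix.map_apply, Matrix.smul_apply,
              Matrix.one_apply, smul_eq_mul]
            split_ifs <;> simp
          rw [this, smul_mul_assoc, one_mul]
  have hAtr : (G * φ.mapMatrix (A.map C)).trace = trSeries A := by
    ext k
    have hmul : ∀ i, (G * φ.mapMatrix (A.map C)) i i
        = ∑ j, PowerSeries.mk (fun k => (A ^ k) i j) * PowerSeries.C (A j i) := by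
      intro i
      rw [Matrix.mul_apply]
      refine Finset.sum_congr rfl fun j _ => ?_
      simp only [RingHom.mapMatrix_apply, Matrix.map_apply, ← hφ, Polynomial.coe_C, G]
    simp only [Matrix.trace, Matrix.diag_apply, hmul, map_sum, trSeries,
      PowerSeries.coeff_mk, PowerSeries.coeff_mul_C, pow_succ, Matrix.mul_apply]
  rw [hφ, hφ, hM, aux_deriv_det, hM']
  have htr : φ (M.adjugate * -A.map C).trace
      = ((M.adjugate * -A.map C).map φ.toAddMonoidHom).trace :=
    AddMonoidHom.map_trace φ.toAddMonoidHom _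
  have : (M.adjugate * -A.map C).map φ = - (φ M.det • (G * φ.mapMatrix (A.map C))) := by
    rw [← RingHom.mapMatrix_apply, mul_neg, map_neg, map_mul, hadj, smul_mul_assoc]
  have h2 : (M.adjugate * -A.map C).map φ.toAddMonoidHom = (M.adjugate * -A.map C).map φ := rfl
  rw [htr, h2, this, Matrix.trace_neg, Matrix.trace_smul, hAtr]
  simp

theorem eval_one_charpolyRev (A : Matrix n n ℝ) : A.charpolyRev.eval 1 = (1 - A).det := by
  rw [Matrix.charpolyRev, ← Polynomial.coe_evalRingHom, RingHom.map_det]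
  congr 1
  ext i j
  simp only [RingHom.mapMatrix_apply, Matrix.map_apply, Matrix.sub_apply, Matrix.smul_apply,
    Matrix.one_apply, smul_eq_mul]
  split_ifs <;> simp

theorem constCoeff_charpolyRev (A : Matrix n n ℝ) :
    PowerSeries.constantCoeff (A.charpolyRev : PowerSeries ℝ) = 1 := by
  have := Matrix.eval_charpolyRev (M := A)
  rw [← Polynomial.coeff_zero_eq_eval_zero] at this
  simpa using this

end LinAlg

theorem det_of_traces {n p ι : Type*} [Fintype n] [DecidableEq n] [Fintype p] [DecidableEq p]
    (s : Finset ι) (κ : ι → Type*) [∀ i, Fintype (κ i)] [∀ i, DecidableEq (κ i)]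
    (A : Matrix n n ℝ) (B : Matrix p p ℝ) (C : ∀ i, Matrix (κ i) (κ i) ℝ) (m : ι → ℤ)
    (h : ∀ k : ℕ, (A ^ k).trace = (B ^ k).trace + ∑ i ∈ s, (m i : ℝ) * (C i ^ k).trace) :
    (1 - A).det * ∏ i ∈ s, (1 - C i).det ^ (-(m i)).toNat
      = (1 - B).det * ∏ i ∈ s, (1 - C i).det ^ (m i).toNat := by
  have key : A.charpolyRev * ∏ i ∈ s, (C i).charpolyRev ^ (-(m i)).toNat
      = B.charpolyRev * ∏ i ∈ s, (C i).charpolyRev ^ (m i).toNat := by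
    have hc : ∀ f : ι → ℕ, Polynomial.coeToPowerSeries.ringHom
        (∏ i ∈ s, (C i).charpolyRev ^ f i)
        = ∏ i ∈ s, ((C i).charpolyRev : PowerSeries ℝ) ^ f i := by
      intro f; rw [map_prod]; simp
    apply Polynomial.coe_injective ℝ
    have e1 := (LD.charpolyRev A).mul (LD.prod s _ _ fun i =>
      (LD.charpolyRev (C i)).pow (-(m i)).toNat)
    have e2 := (LD.charpolyRev B).mul (LD.prod s _ _ fun i =>
      (LD.charpolyRev (C i)).pow (m i).toNat)
    rw [← Polynomial.coeToPowerSeries.ringHom_apply, ← Polynomial.coeToPowerSeries.ringHom_apply,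
      map_mul, map_mul, hc, hc]
    refine LD.unique e1 ?_ ?_ ?_
    · refine Eq.mp (congrArg (LD _) (Eq.symm ?_)) e2
      ext k
      simp only [map_add, map_neg, trSeries, PowerSeries.coeff_mk, map_sum, h (k + 1), map_nsmul]
      simp only [nsmul_eq_mul]
      rw [neg_add, add_assoc, ← Finset.sum_neg_distrib, ← Finset.sum_add_distrib]
      congr 1
      refine Finset.sum_congr rfl fun i _ => ?_
      have : (m i : ℝ) = ((m i).toNat : ℝ) - ((-(m i)).toNat : ℝ) := by
        have : m i = ((m i).toNat : ℤ) - ((-(m i)).toNat : ℤ) := by omega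
        exact_mod_cast this
      rw [this]; ring
    · rw [map_mul, map_prod]
      simp only [map_pow, Polynomial.coeToPowerSeries.ringHom_apply, constCoeff_charpolyRev, one_pow,
        Finset.prod_const_one, mul_one]
    · rw [map_mul, map_prod]
      simp only [map_pow, Polynomial.coeToPowerSeries.ringHom_apply, constCoeff_charpolyRev, one_pow,
        Finset.prod_const_one, mul_one]
  have := congrArg (Polynomial.eval 1) key
  simpa [Polynomial.eval_prod, eval_one_charpolyRev] using this

section Walks
variable {V : Type*}

/-- weighted sum over walks of length `n` from `i`. -/
def Wsum [Fintype V] (M : Matrix V V ℝ) : ℕ → V → (List V → ℝ) → ℝ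
  | 0, _, F => F []
  | n + 1, i, F => ∑ k, M i k * Wsum M n k (fun l => F (k :: l))

theorem Wsum_sum [Fintype V] (M : Matrix V V ℝ) {ι : Type*} (s : Finset ι) (c : ι → ℝ) (n : ℕ)
    (i : V) (F : ι → List V → ℝ) :
    ∑ a ∈ s, c a * Wsum M n i (F a) = Wsum M n i (fun l => ∑ a ∈ s, c a * F a l) := by
  induction n generalizing i F with
  | zero => rfl
  | succ n ih =>
    simp only [Wsum, Finset.mul_sum]
    rw [Finset.sum_comm]
    refine Finset.sum_congr rfl fun k _ => ?_
    rw [← ih, Finset.mul_sum]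
    refine Finset.sum_congr rfl fun a _ => ?_
    ring

theorem Wsum_sum_one [Fintype V] (M : Matrix V V ℝ) {ι : Type*} (s : Finset ι) (n : ℕ)
    (i : V) (F : ι → List V → ℝ) :
    ∑ a ∈ s, Wsum M n i (F a) = Wsum M n i (fun l => ∑ a ∈ s, F a l) := by
  simpa using Wsum_sum M s (fun _ => 1) n i F

theorem Wsum_congr [Fintype V] (M : Matrix V V ℝ) (R : V → V → Prop)
    (hR : ∀ a b, M a b ≠ 0 → R a b) (n : ℕ) (i : V)
    (F F' : List V → ℝ) (h : ∀ l, List.IsChain R (i :: l) → F l = F' l) :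
    Wsum M n i F = Wsum M n i F' := by
  induction n generalizing i F F' with
  | zero => exact h [] (by simp)
  | succ n ih =>
    simp only [Wsum]
    refine Finset.sum_congr rfl fun k _ => ?_
    by_cases hk : M i k = 0
    · simp [hk]
    · congr 1
      apply ih
      intro l hl
      apply h
      exact List.isChain_cons_cons.2 ⟨hR _ _ hk, hl⟩

theorem Wsum_zero [Fintype V] (M : Matrix V V ℝ) (n : ℕ) (i : V) :
    Wsum M n i (fun _ => 0) = 0 := by
  simpa using (Wsum_sum_one M (∅ : Finset ℕ) n i (fun _ _ => 0)).symm

theorem subm_pow [Fintype V] [DecidableEq V] (M : Matrix V V ℝ) (W : Finset V) (n : ℕ) (i j : W) :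
    ((subm M W) ^ n) i j = Wsum M n i (fun l =>
      if (i.1 :: l).getLast (by simp) = j.1 ∧ ∀ v ∈ l, v ∈ W then 1 else 0) := by
  induction n generalizing i with
  | zero =>
    simp only [pow_zero, Wsum, Matrix.one_apply]
    by_cases h : i = j
    · simp [h]
    · simp [h, fun e => h (Subtype.ext e)]
  | succ n ih =>
    rw [pow_succ', Matrix.mul_apply]
    simp only [Wsum, ih]
    have : ∀ k : V, M i k * Wsum M n k (fun l =>
        if (i.1 :: k :: l).getLast (by simp) = j.1 ∧ ∀ v ∈ k :: l, v ∈ W then 1 else 0)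
        = if k ∈ W then M i k * Wsum M n k (fun l =>
        if (k :: l).getLast (by simp) = j.1 ∧ ∀ v ∈ l, v ∈ W then 1 else 0) else 0 := by
      intro k
      split_ifs with hk
      · congr 2
        ext l
        simp [hk]
      · simp [hk, Wsum_zero]
    rw [Finset.sum_congr rfl fun k _ => this k]
    rw [← Finset.sum_filter, Finset.filter_univ_mem]
    rw [← Finset.sum_coe_sort W]
    rfl

theorem subm_trace [Fintype V] [DecidableEq V] (M : Matrix V V ℝ) (W : Finset V) (n : ℕ) :
    ((subm M W) ^ n).trace = ∑ r, Wsum M n r (fun l =>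
      if (r :: l).getLast (by simp) = r ∧ ∀ v ∈ r :: l, v ∈ W then 1 else 0) := by
  rw [Matrix.trace]
  simp only [Matrix.diag_apply, subm_pow]
  rw [Finset.sum_coe_sort W (fun r => Wsum M n r (fun l =>
      if (r :: l).getLast (by simp) = r ∧ ∀ v ∈ l, v ∈ W then 1 else 0))]
  rw [← Finset.sum_subset (Finset.subset_univ W)]
  · refine Finset.sum_congr rfl fun r hr => ?_
    congr 1; ext l; simp [hr]
  · intro r _ hr
    simp [hr, Wsum_zero]

theorem subm_univ_trace [Fintype V] [DecidableEq V] (M : Matrix V V ℝ) (n : ℕ) :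
    ((subm M Finset.univ) ^ n).trace = (M ^ n).trace := by
  let e : (Finset.univ : Finset V) ≃ V := Equiv.subtypeUnivEquiv (by simp)
  have h : subm M Finset.univ = Matrix.reindexAlgEquiv ℝ ℝ e.symm M := by
    ext i j; rfl
  rw [h, ← map_pow, Matrix.trace, Matrix.trace]
  exact Fintype.sum_equiv e _ _ (fun i => rfl)

end Walks

section Trees
variable {V : Type*} [DecidableEq V] (E : Set (V × V))

/-- valid steps -/
def VS (a b : V) : Prop := a = b ∨ (a, b) ∈ E

/-- partial tree -/
def PT (A : Set V) (p : (V → V) × V) : Prop :=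
  p.2 ∈ A ∧ p.1 p.2 = p.2 ∧ (∀ v ∈ A, v ≠ p.2 → (v, p.1 v) ∈ E) ∧ ∀ v ∈ A, ∃ n, p.1^[n] v = p.2

theorem PT_univ (p : (V → V) × V) : PT E Set.univ p ↔ IsSpanningTree E p.2 p.1 := by
  simp [PT, IsSpanningTree]

theorem reach_update (g : V → V) (r j v : V) (n : ℕ) (h : g^[n] v = r) :
    ∃ m, (Function.update (Function.update g r j) j j)^[m] v = j := by
  induction n generalizing v with
  | zero =>
    simp only [Function.iterate_zero, id] at h
    subst h
    refine ⟨1, ?_⟩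
    by_cases hj : v = j
    · simp [hj]
    · simp [Function.update_of_ne hj]
  | succ n ih =>
    by_cases hj : v = j
    · exact ⟨0, hj⟩
    by_cases hr : v = r
    · exact ⟨1, by subst hr; simp [Function.update_of_ne hj]⟩
    · obtain ⟨m, hm⟩ := ih (g v) (by simpa using h)
      refine ⟨m + 1, ?_⟩
      rw [Function.iterate_succ_apply, Function.update_of_ne hj, Function.update_of_ne hr]
      exact hm

theorem stepF_valid (p : (V → V) × V) (j : V) (h : VS E p.2 j) :
    stepF E p j = if j = p.2 then p else
      (Function.update (Function.update p.1 p.2 j) j j, j) := by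
  unfold stepF VS at *
  split_ifs with h1 h2
  · rfl
  · rfl
  · exact absurd (h.resolve_left (fun e => h1 e.symm)) h2

theorem stepF_root (p : (V → V) × V) (j : V) (h : VS E p.2 j) : (stepF E p j).2 = j := by
  rw [stepF_valid E p j h]
  split_ifs with h1
  · exact h1.symm
  · rfl

theorem PT_step (A : Set V) (p : (V → V) × V) (j : V) (h : PT E A p) (hv : VS E p.2 j) :
    PT E (A ∪ {j}) (stepF E p j) := by
  rw [stepF_valid E p j hv]
  obtain ⟨h1, h2, h3, h4⟩ := h
  split_ifs with hj
  · subst hj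
    have : A ∪ {p.2} = A := by simpa using h1
    rw [this]
    exact ⟨h1, h2, h3, h4⟩
  · have hE : (p.2, j) ∈ E := hv.resolve_left (fun e => hj e.symm)
    refine ⟨by simp, by simp, ?_, ?_⟩
    · intro v hv hvj
      simp only at hvj ⊢
      rw [Function.update_of_ne hvj]
      by_cases hr : v = p.2
      · subst hr; simpa using hE
      · rw [Function.update_of_ne hr]
        refine h3 v ?_ hr
        rcases hv with hv | hv
        · exact hv
        · exact absurd hv hvj
    · intro v hv
      rcases hv with hv | hv
      · obtain ⟨n, hn⟩ := h4 v hv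
        exact reach_update _ _ _ _ n hn
      · exact ⟨0, hv⟩

theorem PT_univ_step (p : (V → V) × V) (j : V) (h : PT E Set.univ p) :
    PT E Set.univ (stepF E p j) := by
  by_cases hv : VS E p.2 j
  · simpa using PT_step E _ p j h hv
  · have : stepF E p j = p := by
      unfold stepF VS at *
      push Not at hv
      rw [if_neg (fun e => hv.1 e.symm), if_neg hv.2]
    rwa [this]

/-- step on trees -/
def stepT (t : STree E) (j : V) : STree E :=
  ⟨stepF E t.1 j, (PT_univ E _).1 (PT_univ_step E _ j ((PT_univ E _).2 t.2))⟩

theorem foldl_stepT (t : STree E) (l : List V) :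
    (l.foldl (stepT E) t).1 = l.foldl (stepF E) t.1 := by
  induction l generalizing t with
  | nil => rfl
  | cons a l ih => simp only [List.foldl_cons, ih]; rfl

theorem fold_root (p : (V → V) × V) (l : List V) (h : List.IsChain (VS E) (p.2 :: l)) :
    (l.foldl (stepF E) p).2 = (p.2 :: l).getLast (by simp) := by
  induction l generalizing p with
  | nil => rfl
  | cons a l ih =>
    rw [List.isChain_cons_cons] at h
    have hr := stepF_root E p a h.1
    rw [List.foldl_cons, ih _ (by rw [hr]; exact h.2)]
    simp [hr]

theorem fold_off (p : (V → V) × V) (l : List V) (h : List.IsChain (VS E) (p.2 :: l)) (v : V)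
    (hv : v ∉ p.2 :: l) : (l.foldl (stepF E) p).1 v = p.1 v := by
  induction l generalizing p with
  | nil => rfl
  | cons a l ih =>
    rw [List.isChain_cons_cons] at h
    have hr := stepF_root E p a h.1
    simp only [List.mem_cons, not_or] at hv
    rw [List.foldl_cons, ih _ (by rw [hr]; exact h.2) (by rw [hr]; simp [hv])]
    rw [stepF_valid E p a h.1]
    split_ifs
    · rfl
    · simp [Function.update_of_ne hv.1, Function.update_of_ne hv.2.1]

theorem fold_agree (p q : (V → V) × V) (l : List V) (h : List.IsChain (VS E) (p.2 :: l))
    (hpq : p.2 = q.2) (A : Set V) (hA : ∀ v ∈ A, p.1 v = q.1 v) (hr : p.2 ∈ A)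
    (v : V) (hv : v ∈ A ∨ v ∈ l) :
    (l.foldl (stepF E) p).1 v = (l.foldl (stepF E) q).1 v := by
  induction l generalizing p q A with
  | nil => exact hA v (by simpa using hv)
  | cons a l ih =>
    rw [List.isChain_cons_cons] at h
    have h1 := stepF_root E p a h.1
    have h2 := stepF_root E q a (hpq ▸ h.1)
    rw [List.foldl_cons, List.foldl_cons]
    refine ih _ _ (by rw [h1]; exact h.2) (by rw [h1, h2]) (A ∪ {a}) ?_ (by rw [h1]; simp) ?_
    · intro u hu
      rw [stepF_valid E p a h.1, stepF_valid E q a (hpq ▸ h.1), ← hpq]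
      split_ifs with ha
      · subst ha
        rcases hu with hu | hu
        · exact hA u hu
        · exact hA u (by rw [hu]; exact hr)
      · simp only
        by_cases hua : u = a
        · subst hua; simp
        · rw [Function.update_of_ne hua, Function.update_of_ne hua]
          by_cases hup : u = p.2
          · subst hup; simp
          · rw [Function.update_of_ne hup, Function.update_of_ne hup]
            exact hA u (hu.resolve_right hua)
    · simp only [List.mem_cons] at hv
      simp only [Set.mem_union, Set.mem_singleton_iff]
      tauto

theorem PT_fold (p : (V → V) × V) (l : List V) (h : List.IsChain (VS E) (p.2 :: l))
    (A : Set V) (hp : PT E A p) : PT E (A ∪ {v | v ∈ l}) (l.foldl (stepF E) p) := by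
  induction l generalizing p A with
  | nil => simpa using hp
  | cons a l ih =>
    rw [List.isChain_cons_cons] at h
    have h1 := stepF_root E p a h.1
    have := ih _ (by rw [h1]; exact h.2) _ (PT_step E A p a hp h.1)
    rw [List.foldl_cons]
    convert this using 1
    ext v; simp only [Set.mem_union, Set.mem_ofPred_eq, List.mem_cons, Set.mem_singleton_iff]; tauto

theorem reach_off (U : Set V) (f g : V → V) (hfg : ∀ v, v ∉ U → f v = g v) (n : ℕ) (v : V)
    (h : f^[n] v ∈ U) : ∃ m, g^[m] v ∈ U := by
  induction n generalizing v with
  | zero => exact ⟨0, h⟩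
  | succ n ih =>
    by_cases hv : v ∈ U
    · exact ⟨0, hv⟩
    · obtain ⟨m, hm⟩ := ih (f v) (by simpa using h)
      exact ⟨m + 1, by rw [Function.iterate_succ_apply, ← hfg v hv]; exact hm⟩

theorem count_fixed (r : V) (l : List V) (h : List.IsChain (VS E) (r :: l))
    (hlast : (r :: l).getLast (by simp) = r) :
    Nat.card {t : STree E // t.root = r ∧ l.foldl (stepT E) t = t}
      = kForest E (r :: l).toFinset := by
  unfold kForest
  have hmem : ∀ v, v ∈ (r :: l).toFinset ↔ v ∈ r :: l := fun v => List.mem_toFinset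
  have hfix : ∀ t : STree E, l.foldl (stepT E) t = t → l.foldl (stepF E) t.1 = t.1 := by
    intro t ht; rw [← foldl_stepT, ht]
  refine Nat.card_eq_of_bijective (fun t => ⟨fun v => if v ∈ (r :: l).toFinset then v
      else t.1.tree v, ?_, ?_, ?_⟩) ⟨?_, ?_⟩
  · intro w hw; simp only [if_pos hw]
  · intro v hv
    simp only [if_neg hv]
    refine t.1.2.2.1 v ?_
    have : t.1.1.2 = r := t.2.1
    rw [this]
    rintro rfl
    exact hv (by simp)
  · intro v
    obtain ⟨n, hn⟩ := t.1.2.2.2 v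
    refine reach_off (↑(r :: l).toFinset) t.1.tree _ (fun v hv => ?_) n v ?_
    · rw [if_neg (by simpa using hv)]
    · have : t.1.1.2 = r := t.2.1
      have e : t.1.tree^[n] v = r := hn.trans this
      rw [e]; simp
  · rintro ⟨t, ht, ht'⟩ ⟨u, hu, hu'⟩ htu
    have htu := fun v => congrFun (Subtype.ext_iff.1 htu) v
    simp only at htu
    have e2 : t.1.2 = r := ht
    have e3 : u.1.2 = r := hu
    have : t = u := by
      apply Subtype.ext
      refine Prod.ext ?_ (ht.trans hu.symm)
      funext v
      by_cases hv : v ∈ (r :: l).toFinset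
      · rw [← hfix t ht', ← hfix u hu']
        refine fold_agree E _ _ l (by rw [e2]; exact h) (ht.trans hu.symm) {r} ?_ e2 v
          (by simpa using hv)
        rintro v rfl
        have a1 : t.1.1 t.1.2 = t.1.2 := t.2.1
        have a2 : u.1.1 u.1.2 = u.1.2 := u.2.1
        rw [e2] at a1; rw [e3] at a2; rw [a1, a2]
      · have := htu v
        rw [if_neg hv, if_neg hv] at this
        exact this
    subst this; rfl
  · rintro ⟨f, hf1, hf2, hf3⟩
    have hpt : PT E {r} (f, r) := by
      refine ⟨rfl, hf1 r (by simp), ?_, ?_⟩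
      · intro v hv hv'; exact absurd hv hv'
      · intro v hv; exact ⟨0, hv⟩
    have hpt' := PT_fold E (f, r) l h _ hpt
    have hoff := fold_off E (f, r) l h
    have hroot : (l.foldl (stepF E) (f, r)).2 = r := (fold_root E (f, r) l h).trans hlast
    set q := l.foldl (stepF E) (f, r) with hq
    obtain ⟨q1, q2, q3, q4⟩ := hpt'
    have hU : ∀ v, v ∈ ({r} ∪ {v | v ∈ l} : Set V) ↔ v ∈ r :: l := by intro v; simp
    have hst : IsSpanningTree E q.2 q.1 := by
      refine ⟨q2, ?_, ?_⟩
      · intro v hv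
        by_cases hvU : v ∈ r :: l
        · exact q3 v ((hU v).2 hvU) hv
        · rw [hoff v hvU]
          exact hf2 v (by rwa [hmem])
      · intro v
        obtain ⟨n, hn⟩ := hf3 v
        obtain ⟨m, hm⟩ := reach_off {v | v ∈ r :: l} f q.1 (fun v hv => (hoff v hv).symm) n v
          ((hmem _).1 hn)
        obtain ⟨k, hk⟩ := q4 _ ((hU _).2 hm)
        exact ⟨k + m, by rw [Function.iterate_add_apply]; exact hk⟩
    have hchain : List.IsChain (VS E) (q.2 :: l) := by rw [hroot]; exact h
    refine ⟨⟨⟨q, hst⟩, hroot, ?_⟩, ?_⟩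
    · apply Subtype.ext
      rw [foldl_stepT]
      simp only
      refine Prod.ext ?_ ?_
      · funext v
        by_cases hv : v ∈ r :: l
        · conv_rhs => rw [hq]
          refine fold_agree E _ _ l hchain hroot {r} ?_ hroot v (by simpa using hv)
          rintro v rfl
          rw [hroot] at q2
          rw [q2]
          exact (hf1 v (by simp)).symm
        · exact fold_off E q l hchain v (by rw [hroot]; exact hv)
      · rw [fold_root E q l hchain]
        simp only [hroot]
        exact hlast
    · apply Subtype.ext
      funext v
      simp only
      split_ifs with hv
      · exact (hf1 v hv).symm
      · exact hoff v (by rwa [hmem] at hv)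

theorem chain_reach (U : Finset V) (r : V) (l : List V) (h : List.IsChain (VS E) (r :: l))
    (hU : ∀ v ∈ r :: l, v ∈ U) :
    ∀ v ∈ r :: l,
      Relation.ReflTransGen (fun a b => a ∈ U ∧ b ∈ U ∧ (a, b) ∈ E) r v ∧
      Relation.ReflTransGen (fun a b => a ∈ U ∧ b ∈ U ∧ (a, b) ∈ E) v
        ((r :: l).getLast (by simp)) := by
  induction l generalizing r with
  | nil => intro v hv; simp at hv; subst hv; exact ⟨.refl, .refl⟩
  | cons a l ih =>
    rw [List.isChain_cons_cons] at h
    have ih' := ih a h.2 (fun v hv => hU v (List.mem_cons_of_mem _ hv))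
    have hra : Relation.ReflTransGen (fun a b => a ∈ U ∧ b ∈ U ∧ (a, b) ∈ E) r a := by
      rcases h.1 with e | e
      · rw [e]
      · exact .single ⟨hU _ (by simp), hU _ (by simp), e⟩
    have hl : (r :: a :: l).getLast (by simp) = (a :: l).getLast (by simp) := by simp
    rw [hl]
    intro v hv
    rcases List.mem_cons.1 hv with e | e
    · subst e
      exact ⟨.refl, hra.trans (ih' a (by simp)).2⟩
    · exact ⟨hra.trans (ih' v e).1, (ih' v e).2⟩

theorem chain_sc (r : V) (l : List V) (h : List.IsChain (VS E) (r :: l))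
    (hlast : (r :: l).getLast (by simp) = r) : StronglyConnectedSub E (r :: l).toFinset := by
  have := chain_reach E (r :: l).toFinset r l h (fun v hv => List.mem_toFinset.2 hv)
  rw [hlast] at this
  refine ⟨⟨r, by simp⟩, fun u hu v hv => ?_⟩
  exact (this u (List.mem_toFinset.1 hu)).2.trans (this v (List.mem_toFinset.1 hv)).1

end Trees

section Final
variable {V : Type*} [Fintype V] [DecidableEq V] (E : Set (V × V))

theorem lift_entry (P : Matrix V V ℝ) (hP : IsTransMatrix E P) (s : V → ℝ) (t t' : STree E) :
    s t.root * liftP E P t t'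
      = ∑ j, (Matrix.diagonal s * P) t.root j * (if stepT E t j = t' then 1 else 0) := by
  have hz : ∀ a b, a ≠ b → (a, b) ∉ E → P a b = 0 := by
    intro a b hab hE
    by_contra h
    exact hE ((hP.2.2 a b hab).1 (lt_of_le_of_ne (hP.1 a b) (Ne.symm h)))
  simp only [Matrix.diagonal_mul, mul_assoc]
  rw [← Finset.mul_sum]
  congr 1
  rw [Finset.sum_eq_single t'.root]
  · have hr : ∀ u : STree E, u.root = u.1.2 := fun _ => rfl
    unfold liftP
    by_cases h : t = t'
    · subst h
      have : stepT E t t.root = t := by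
        apply Subtype.ext
        simp [stepT, stepF, hr]
      simp [this]
    · rw [if_neg h]
      by_cases hroot : t.root = t'.root
      · have hs : stepT E t t'.root = t := by
          apply Subtype.ext
          simp [stepT, stepF, ← hroot, hr]
        rw [hs, if_neg h, if_neg (fun he => he.1 hroot), mul_zero]
      · by_cases hE : (t.root, t'.root) ∈ E
        · have : STreeEdge E t t' ↔ stepT E t t'.root = t' := by
            unfold STreeEdge stepT
            rw [Subtype.ext_iff]
            simp only
            unfold stepF
            rw [if_neg (fun e => hroot e.symm), if_pos (show (t.1.2, t'.root) ∈ E from hE), Prod.ext_iff]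
            constructor
            · rintro ⟨-, -, h3⟩
              exact ⟨h3.symm, rfl⟩
            · rintro ⟨h3, -⟩
              exact ⟨hroot, hE, h3.symm⟩
          simp [this]
        · rw [if_neg (fun he => hE he.2.1), hz _ _ hroot hE, zero_mul]
  · intro j _ hj
    by_cases hv : VS E t.root j
    · have : stepT E t j ≠ t' := by
        intro h
        apply hj
        rw [← h]
        exact (stepF_root E t.1 j hv).symm
      simp [this]
    · unfold VS at hv
      push Not at hv
      rw [hz _ _ hv.1 hv.2, zero_mul]
  · intro h; exact absurd (Finset.mem_univ _) h

theorem lift_pow [DecidableEq (STree E)] (P : Matrix V V ℝ) (hP : IsTransMatrix E P) (s : V → ℝ) (n : ℕ)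
    (t t' : STree E) :
    ((Matrix.diagonal (fun t : STree E => s t.root) * liftP E P) ^ n) t t'
      = Wsum (Matrix.diagonal s * P) n t.root
        (fun l => if l.foldl (stepT E) t = t' then 1 else 0) := by
  induction n generalizing t with
  | zero =>
    simp only [Wsum, Matrix.one_apply, pow_zero, List.foldl_nil]
    congr!
  | succ n ih =>
    rw [pow_succ', Matrix.mul_apply]
    simp only [Matrix.diagonal_mul, lift_entry E P hP s, ih, Wsum, Finset.sum_mul]
    rw [Finset.sum_comm]
    refine Finset.sum_congr rfl fun j _ => ?_
    rw [Finset.sum_eq_single (stepT E t j)]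
    · by_cases hM : P t.root j = 0
      · simp [Matrix.diagonal_mul, hM]
      · have hv : VS E t.root j := by
          by_cases h : t.root = j
          · exact Or.inl h
          · exact Or.inr ((hP.2.2 _ _ h).1 (lt_of_le_of_ne (hP.1 _ _) (Ne.symm hM)))
        have : (stepT E t j).root = j := stepF_root E t.1 j hv
        rw [this, if_pos rfl, mul_one]
        simp only [List.foldl_cons]
        try congr!
    · intro u _ hu
      simp [Ne.symm hu]
    · intro h; exact absurd (Finset.mem_univ _) h

theorem lift_trace [DecidableEq (STree E)] (P : Matrix V V ℝ) (hP : IsTransMatrix E P) (s : V → ℝ)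
    (n : ℕ) :
    ((Matrix.diagonal (fun t : STree E => s t.root) * liftP E P) ^ n).trace
      = ∑ r, Wsum (Matrix.diagonal s * P) n r
        (fun l => (Nat.card {t : STree E // t.root = r ∧ l.foldl (stepT E) t = t} : ℝ)) := by
  rw [Matrix.trace]
  simp only [Matrix.diag_apply, lift_pow E P hP]
  rw [← Finset.sum_fiberwise (s := Finset.univ) (g := fun t : STree E => t.root)]
  refine Finset.sum_congr rfl fun r _ => ?_
  rw [Finset.sum_congr rfl (g := fun t : STree E => Wsum (Matrix.diagonal s * P) n r
        (fun l => if l.foldl (stepT E) t = t then 1 else 0))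
        (fun t ht => by rw [(Finset.mem_filter.1 ht).2]), Wsum_sum_one]
  congr 1
  ext l
  rw [Finset.sum_boole, Finset.filter_filter, Nat.card_eq_fintype_card, Fintype.card_subtype]

theorem kForest_univ : kForest E (Finset.univ : Finset V) = 1 := by
  unfold kForest
  rw [Nat.card_eq_one_iff_unique]
  refine ⟨⟨fun f g => ?_⟩, ⟨⟨id, ?_, ?_, ?_⟩⟩⟩
  · apply Subtype.ext; funext v
    rw [f.2.1 v (by simp), g.2.1 v (by simp)]
  · intro w _; rfl
  · intro v hv; simp at hv
  · intro v; exact ⟨0, by simp⟩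

theorem trace_identity [DecidableEq (STree E)] (P : Matrix V V ℝ) (hP : IsTransMatrix E P)
    [Nonempty V] (hconn : StronglyConnected E)
    (m' : Finset V → ℤ)
    (hm'univ : m' Finset.univ = 1)
    (hm' : ∀ W : Finset V, StronglyConnectedSub E W → W ≠ Finset.univ →
      m' W = (kForest E W : ℤ) -
        ∑ W' ∈ Finset.univ.filter (fun W' => StronglyConnectedSub E W' ∧ W ⊂ W'), m' W')
    (s : V → ℝ) (n : ℕ) :
    ((Matrix.diagonal (fun t : STree E => s t.root) * liftP E P) ^ n).trace
      = ((Matrix.diagonal s * P) ^ n).trace +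
        ∑ W ∈ Finset.univ.filter (fun W : Finset V =>
          StronglyConnectedSub E W ∧ W ≠ Finset.univ),
          (m' W : ℝ) * ((subm (Matrix.diagonal s * P) W) ^ n).trace := by
  have hscuniv : StronglyConnectedSub E (Finset.univ : Finset V) := by
    refine ⟨Finset.univ_nonempty, fun u _ v _ => ?_⟩
    simpa using hconn u v
  have hsum : ∀ U : Finset V, StronglyConnectedSub E U →
      ∑ W ∈ Finset.univ.filter (fun W => StronglyConnectedSub E W ∧ U ⊆ W), m' W = kForest E U := by
    intro U hU
    have hins : Finset.univ.filter (fun W => StronglyConnectedSub E W ∧ U ⊆ W)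
        = insert U (Finset.univ.filter (fun W => StronglyConnectedSub E W ∧ U ⊂ W)) := by
      ext W
      simp only [Finset.mem_filter, Finset.mem_univ, true_and, Finset.mem_insert]
      constructor
      · rintro ⟨h1, h2⟩
        rcases eq_or_ne U W with e | e
        · exact Or.inl e.symm
        · exact Or.inr ⟨h1, lt_of_le_of_ne h2 e⟩
      · rintro (rfl | ⟨h1, h2⟩)
        · exact ⟨hU, subset_rfl⟩
        · exact ⟨h1, h2.1⟩
    rw [hins, Finset.sum_insert (by simp)]
    by_cases hu : U = Finset.univ
    · subst hu
      rw [kForest_univ, hm'univ, Finset.filter_false_of_mem]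
      · simp
      · rintro W - ⟨-, h⟩
        exact h.2 (Finset.subset_univ W)
    · rw [hm' U hU hu]; ring
  have hsplit : ((Matrix.diagonal s * P) ^ n).trace +
        ∑ W ∈ Finset.univ.filter (fun W : Finset V =>
          StronglyConnectedSub E W ∧ W ≠ Finset.univ),
          (m' W : ℝ) * ((subm (Matrix.diagonal s * P) W) ^ n).trace
      = ∑ W ∈ Finset.univ.filter (fun W : Finset V => StronglyConnectedSub E W),
          (m' W : ℝ) * ((subm (Matrix.diagonal s * P) W) ^ n).trace := by
    have hins : Finset.univ.filter (fun W : Finset V => StronglyConnectedSub E W)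
        = insert Finset.univ (Finset.univ.filter (fun W : Finset V =>
          StronglyConnectedSub E W ∧ W ≠ Finset.univ)) := by
      ext W
      simp only [Finset.mem_filter, Finset.mem_univ, true_and, Finset.mem_insert]
      constructor
      · intro h; by_cases e : W = Finset.univ
        · exact Or.inl e
        · exact Or.inr ⟨h, e⟩
      · rintro (rfl | h)
        · exact hscuniv
        · exact h.1
    rw [hins, Finset.sum_insert (by simp), subm_univ_trace, hm'univ]
    simp
  rw [hsplit, lift_trace E P hP]
  simp only [subm_trace, Finset.mul_sum]
  rw [Finset.sum_comm]
  refine Finset.sum_congr rfl fun r _ => ?_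
  rw [Wsum_sum]
  refine Wsum_congr _ (VS E) ?_ n r _ _ ?_
  · intro a b hab
    rw [Matrix.diagonal_mul] at hab
    have hM : P a b ≠ 0 := right_ne_zero_of_mul hab
    by_cases h : a = b
    · exact Or.inl h
    · exact Or.inr ((hP.2.2 _ _ h).1 (lt_of_le_of_ne (hP.1 _ _) (Ne.symm hM)))
  · intro l hl
    by_cases hlast : (r :: l).getLast (by simp) = r
    · rw [count_fixed E r l hl hlast]
      have := hsum _ (chain_sc E r l hl hlast)
      have h2 : (kForest E (r :: l).toFinset : ℝ) = ((kForest E (r :: l).toFinset : ℤ) : ℝ) := by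
        simp
      rw [h2, ← this, ← Finset.filter_filter, Finset.sum_filter, Int.cast_sum]
      refine Finset.sum_congr rfl fun W _ => ?_
      have h3 : (r :: l).toFinset ⊆ W ↔ ∀ v ∈ r :: l, v ∈ W := by
        simp only [Finset.subset_iff, List.mem_toFinset]
      by_cases h4 : (r :: l).toFinset ⊆ W
      · rw [if_pos h4, if_pos ⟨hlast, h3.1 h4⟩, mul_one]
      · rw [if_neg h4, if_neg (fun h => h4 (h3.2 h.2))]; simp
    · have hempty : IsEmpty {t : STree E // t.root = r ∧ l.foldl (stepT E) t = t} := by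
        refine ⟨fun ⟨t, h1, h2⟩ => hlast ?_⟩
        have e : t.1.2 = r := h1
        have := fold_root E t.1 l (by rw [e]; exact hl)
        rw [← foldl_stepT, h2] at this
        simp only [e] at this
        exact this.symm
      simp [hlast]

end Final

/-- the vertex-weighted ratio formula:
`det(1 - S̄P̄)/det(1 - SP) = ∏_W det((1 - SP)|_W)^{m'(W)}` over strongly connected
proper subsets `W ⊊ V`, where `S = diag(s)` and `S̄` is its lift. -/
theorem stmt9 {V : Type*} [Fintype V] [DecidableEq V] [Nonempty V]
    (E : Set (V × V)) (hloop : ∀ v : V, (v, v) ∉ E) (hconn : StronglyConnected E)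
    (P : Matrix V V ℝ) (hP : IsTransMatrix E P)
    (m' : Finset V → ℤ)
    (hm'univ : m' Finset.univ = 1)
    (hm' : ∀ W : Finset V, StronglyConnectedSub E W → W ≠ Finset.univ →
      m' W = (kForest E W : ℤ) -
        ∑ W' ∈ Finset.univ.filter (fun W' => StronglyConnectedSub E W' ∧ W ⊂ W'), m' W')
    (s : V → ℝ) :
    Matrix.det (1 - Matrix.diagonal (fun t : STree E => s t.root) * liftP E P) *
      ∏ W ∈ Finset.univ.filter (fun W : Finset V =>
          StronglyConnectedSub E W ∧ W ≠ Finset.univ),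
        Matrix.det (subm (1 - Matrix.diagonal s * P) W) ^ (-(m' W)).toNat
    = Matrix.det (1 - Matrix.diagonal s * P) *
      ∏ W ∈ Finset.univ.filter (fun W : Finset V =>
          StronglyConnectedSub E W ∧ W ≠ Finset.univ),
        Matrix.det (subm (1 - Matrix.diagonal s * P) W) ^ (m' W).toNat := by
  have h := det_of_traces (κ := fun W : Finset V => W) _ _ _
    (fun W => subm (Matrix.diagonal s * P) W) m' (trace_identity E P hP hconn m' hm'univ hm' s)
  have hs : ∀ W : Finset V, subm (1 - Matrix.diagonal s * P) W
      = 1 - subm (Matrix.diagonal s * P) W := by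
    intro W; ext i j
    by_cases h : i = j
    · simp [subm, Matrix.one_apply, h]
    · have h' : ¬ (i : V) = j := fun e => h (Subtype.ext e)
      simp [subm, Matrix.one_apply, h, h']
  simp only [hs]
  convert h using 2
end
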